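/- Let K satisfy Assumption A and let f_in be a nonzero nonnegative Radon measure on (0,∞) with ∫(1+v^γ) f_in(dv) < ∞ and ∫ v f_in(dv) < ∞ which is not a single Dirac measure (there are no M, V ∈ (0,∞) with f_in = M·δ_V). Then for every T > 0 there exists no mass-conserving weak solution of the coagulation equation on [0,T] with kernel K and initial datum f_in. -/

import Mathlib

open MeasureTheory Set Filter

noncomputable section

/-- Assumption A on the coagulation kernel `K(v,v') = h(v,v') g(v/(v+v'))`. -/
structure KernelAssumptionA (K : ℝ → ℝ → ℝ) (h : ℝ → ℝ → ℝ) (g : ℝ → ℝ)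
    (γ H H₀ H₁ G₀ G₁ k : ℝ) : Prop where
  K_nonneg : ∀ v v', 0 ≤ v → 0 ≤ v' → 0 ≤ K v v'
  K_eq : ∀ v v', 0 ≤ v → 0 ≤ v' → 0 < v + v' →
      K v v' = h v v' * g (v / (v + v'))
  h_cont : ContinuousOn (fun p : ℝ × ℝ => h p.1 p.2) (Ici 0 ×ˢ Ici 0)
  h_symm : ∀ v v', h v v' = h v' v
  γ_gt_one : 1 < γ
  H_gt_one : 1 < H
  H₀_pos : 0 < H₀
  h_lower : ∀ v v', 0 ≤ v → 0 ≤ v' → H < v + v' →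
      H₀ * (v ^ γ + v' ^ γ) ≤ h v v'
  h_posOn : ∀ R : ℝ, 0 < R → ∃ C : ℝ, 0 < C ∧
      ∀ v ∈ Icc (1 / R) R, ∀ v' ∈ Icc (1 / R) R, C ≤ h v v'
  H₁_pos : 0 < H₁
  h_upper : ∀ v v', 0 ≤ v → 0 ≤ v' → h v v' ≤ H₁ * (v ^ γ + v' ^ γ)
  g_cont : ContinuousOn g (Icc 0 1)
  g_symm : ∀ x ∈ Icc (0 : ℝ) 1, g x = g (1 - x)
  g_half : g (1 / 2) = 0
  G₀_pos : 0 < G₀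
  G₁_pos : 0 < G₁
  k_ge_one : 1 ≤ k
  g_lower : ∀ x ∈ Icc (0 : ℝ) 1, G₀ * |x - 1 / 2| ^ k ≤ g x
  g_upper : ∀ x ∈ Icc (0 : ℝ) 1, g x ≤ G₁

/-- Weak solution of the coagulation equation on `[0, T]` with kernel `K`
and initial datum `fin`, in the sense of measures on `(0,∞)`. -/
structure IsWeakSolution (K : ℝ → ℝ → ℝ) (γ T : ℝ)
    (f : ℝ → Measure ℝ) (fin : Measure ℝ) : Prop where
  conc : ∀ t ∈ Icc (0 : ℝ) T, f t (Iic 0) = 0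
  time_cont : ∀ φ : ℝ → ℝ, Continuous φ → (∃ M : ℝ, ∀ v, |φ v| ≤ M) →
      ContinuousOn (fun t => ∫ v, φ v ∂(f t)) (Icc (0 : ℝ) T)
  moment_bound : ∃ C : ℝ, ∀ t ∈ Icc (0 : ℝ) T,
      Integrable (fun v => 1 + v ^ γ) (f t) ∧ (∫ v, (1 + v ^ γ) ∂(f t)) ≤ C
  weak_form : ∀ φ : ℝ → ℝ, Continuous φ → HasCompactSupport φ →
      tsupport φ ⊆ Ioi 0 → ∀ t ∈ Icc (0 : ℝ) T,
      (∫ v, φ v ∂(f t)) - (∫ v, φ v ∂fin) =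
        (1 / 2) * ∫ s in (0 : ℝ)..t,
          (∫ v, (∫ v', K v v' * (φ (v + v') - φ v - φ v') ∂(f s)) ∂(f s))

/-- The solution conserves mass on `[0, T]`. -/
def IsMassConserving (T : ℝ) (f : ℝ → Measure ℝ) (fin : Measure ℝ) : Prop :=
  Integrable (fun v => v) fin ∧
    ∀ t ∈ Icc (0 : ℝ) T,
      Integrable (fun v => v) (f t) ∧ (∫ v, v ∂(f t)) = ∫ v, v ∂fin

/-- `μ` is a single Dirac measure `M • δ_V` with `M, V ∈ (0,∞)`. -/
def IsSingleDirac (μ : Measure ℝ) : Prop :=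
  ∃ M V : ℝ, 0 < M ∧ 0 < V ∧ μ = ENNReal.ofReal M • Measure.dirac V

/-! ### Internal set-up -/

/-- The gain-minus-loss integrand. -/
def Dg (K : ℝ × ℝ → ℝ) (φ : ℝ → ℝ) (p : ℝ × ℝ) : ℝ :=
  K p * (φ (p.1 + p.2) - φ p.1 - φ p.2)

/-- The coagulation operator tested against `φ`. -/
def Ig (K : ℝ × ℝ → ℝ) (φ : ℝ → ℝ) (μ : Measure ℝ) : ℝ :=
  ∫ p, Dg K φ p ∂(μ.prod μ)

/-- Normalised solutions: total family of finite measures, measurable kernel. -/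
structure Sol (K : ℝ × ℝ → ℝ) (γ T C C0 : ℝ) (f : ℝ → Measure ℝ) : Prop where
  T_pos : 0 < T
  γ_gt : 1 < γ
  C_nonneg : 0 ≤ C
  C0_nonneg : 0 ≤ C0
  K_meas : Measurable K
  K_nonneg : ∀ p, 0 ≤ K p
  K_le : ∀ p, K p ≤ C0 * (|p.1| ^ γ + |p.2| ^ γ)
  fin : ∀ s, IsFiniteMeasure (f s)
  conc : ∀ s, ∀ᵐ v ∂(f s), 0 < v
  meas : Measurable f
  momγ_int : ∀ s, Integrable (fun v => |v| ^ γ) (f s)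
  mom1_int : ∀ s, Integrable (fun v : ℝ => |v|) (f s)
  mass_le : ∀ s, (f s).real univ ≤ C
  momγ_le : ∀ s, ∫ v, |v| ^ γ ∂(f s) ≤ C
  mom1_le : ∀ s, ∫ v, |v| ∂(f s) ≤ C
  weak : ∀ φ : ℝ → ℝ, Continuous φ → HasCompactSupport φ →
      tsupport φ ⊆ Ioi 0 → ∀ t ∈ Icc (0 : ℝ) T,
      (∫ v, φ v ∂(f t)) - (∫ v, φ v ∂(f 0)) =
        (1 / 2) * ∫ s in (0 : ℝ)..t, Ig K φ (f s)

/-- Elementary Lipschitz predicate. -/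
def Lip (L : ℝ) (φ : ℝ → ℝ) : Prop := ∀ x y, |φ x - φ y| ≤ L * |x - y|

lemma Lip.continuous {L : ℝ} {φ : ℝ → ℝ} (h : Lip L φ) (hL : 0 ≤ L) : Continuous φ := by
  have : LipschitzWith ⟨L, hL⟩ φ := LipschitzWith.of_dist_le_mul (fun x y => by
    rw [Real.dist_eq, Real.dist_eq]; exact h x y)
  exact this.continuous

lemma Lip.abs_le {L : ℝ} {φ : ℝ → ℝ} (h : Lip L φ) (h0 : φ 0 = 0) (v : ℝ) :
    |φ v| ≤ L * |v| := by
  simpa [h0] using h v 0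

lemma Lip.min {L : ℝ} {φ ψ : ℝ → ℝ} (h : Lip L φ) (h' : Lip L ψ) :
    Lip L (fun v => min (φ v) (ψ v)) := by
  intro x y
  exact (abs_min_sub_min_le_max _ _ _ _).trans (max_le (h x y) (h' x y))

section SolLemmas

variable {K : ℝ × ℝ → ℝ} {γ T C C0 : ℝ} {f : ℝ → Measure ℝ}

/-- The dominating function. -/
def domF (γ : ℝ) (p : ℝ × ℝ) : ℝ := |p.1| ^ γ * |p.2| + |p.1| * |p.2| ^ γ

lemma Sol.Dg_bound (S : Sol K γ T C C0 f) {L : ℝ} (_hL : 0 ≤ L) {φ : ℝ → ℝ} (h : Lip L φ)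
    (h0 : φ 0 = 0) (p : ℝ × ℝ) : |Dg K φ p| ≤ 2 * L * C0 * domF γ p := by
  have hK := S.K_le p
  have hK0 := S.K_nonneg p
  obtain ⟨a, b⟩ := p
  simp only [Dg, domF] at *
  have e1 : |φ (a + b) - φ a - φ b| ≤ 2 * L * |b| := by
    have h1 := h (a + b) a
    have h2 := h.abs_le h0 b
    rw [add_sub_cancel_left] at h1
    have := abs_sub (φ (a + b) - φ a) (φ b)
    linarith
  have e2 : |φ (a + b) - φ a - φ b| ≤ 2 * L * |a| := by
    have h1 := h (a + b) b
    have h2 := h.abs_le h0 a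
    rw [add_sub_cancel_right] at h1
    have := abs_sub (φ (a + b) - φ b) (φ a)
    rw [show φ (a + b) - φ a - φ b = φ (a + b) - φ b - φ a by ring]
    linarith
  have ha : 0 ≤ |a| ^ γ := by positivity
  have hb : 0 ≤ |b| ^ γ := by positivity
  have hC := S.C0_nonneg
  rw [abs_mul, abs_of_nonneg hK0]
  set X := |φ (a + b) - φ a - φ b|
  have hX : 0 ≤ X := abs_nonneg _
  calc K (a, b) * X ≤ C0 * (|a| ^ γ + |b| ^ γ) * X := by gcongr
    _ = C0 * (|a| ^ γ * X + |b| ^ γ * X) := by ring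
    _ ≤ C0 * (|a| ^ γ * (2 * L * |b|) + |b| ^ γ * (2 * L * |a|)) := by gcongr
    _ = _ := by ring

lemma Sol.domF_int (S : Sol K γ T C C0 f) (s : ℝ) :
    Integrable (domF γ) ((f s).prod (f s)) := by
  have := S.fin s
  exact ((S.momγ_int s).mul_prod (S.mom1_int s)).add ((S.mom1_int s).mul_prod (S.momγ_int s))

lemma Sol.domF_le (S : Sol K γ T C C0 f) (s : ℝ) :
    ∫ p, domF γ p ∂((f s).prod (f s)) ≤ 2 * C * C := by
  have := S.fin s
  have e : ∫ p, domF γ p ∂((f s).prod (f s)) =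
      (∫ v, |v| ^ γ ∂(f s)) * (∫ v, |v| ∂(f s)) + (∫ v, |v| ∂(f s)) * (∫ v, |v| ^ γ ∂(f s)) := by
    unfold domF
    rw [integral_add ((S.momγ_int s).mul_prod (S.mom1_int s))
      ((S.mom1_int s).mul_prod (S.momγ_int s)),
      integral_prod_mul (fun v : ℝ => |v| ^ γ) (fun v : ℝ => |v|),
      integral_prod_mul (fun v : ℝ => |v|) (fun v : ℝ => |v| ^ γ)]
  rw [e]
  have h1 := S.momγ_le s
  have h2 := S.mom1_le s
  have h3 : 0 ≤ ∫ v, |v| ^ γ ∂(f s) := integral_nonneg (fun v => by positivity)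
  have h4 : 0 ≤ ∫ v, |v| ∂(f s) := integral_nonneg (fun v => by positivity)
  have := mul_le_mul h1 h2 h4 S.C_nonneg
  linarith

lemma Sol.Dg_meas (S : Sol K γ T C C0 f) {φ : ℝ → ℝ} (h : Continuous φ) :
    Measurable (Dg K φ) := by
  have := S.K_meas
  have := h.measurable
  unfold Dg
  fun_prop

lemma Sol.Dg_int (S : Sol K γ T C C0 f) {L : ℝ} (hL : 0 ≤ L) {φ : ℝ → ℝ} (h : Lip L φ)
    (h0 : φ 0 = 0) (s : ℝ) : Integrable (Dg K φ) ((f s).prod (f s)) := by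
  refine Integrable.mono' ((S.domF_int s).const_mul (2 * L * C0))
    (S.Dg_meas (h.continuous hL)).aestronglyMeasurable (ae_of_all _ fun p => ?_)
  exact S.Dg_bound hL h h0 p

lemma Sol.Ig_abs_le (S : Sol K γ T C C0 f) {L : ℝ} (hL : 0 ≤ L) {φ : ℝ → ℝ} (h : Lip L φ)
    (h0 : φ 0 = 0) (s : ℝ) : |Ig K φ (f s)| ≤ 2 * L * C0 * (2 * C * C) := by
  have h1 : ‖Ig K φ (f s)‖ ≤ ∫ p, 2 * L * C0 * domF γ p ∂((f s).prod (f s)) :=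
    norm_integral_le_of_norm_le ((S.domF_int s).const_mul (2 * L * C0))
      (ae_of_all _ fun p => S.Dg_bound hL h h0 p)
  rw [integral_const_mul] at h1
  refine h1.trans ?_
  have := S.domF_le s
  have := S.C0_nonneg
  gcongr

lemma Sol.Ig_meas (S : Sol K γ T C C0 f) {φ : ℝ → ℝ} (h : Continuous φ) :
    StronglyMeasurable (fun s => Ig K φ (f s)) := by
  let κ : ProbabilityTheory.Kernel ℝ ℝ := ⟨f, S.meas⟩
  have hκ : ProbabilityTheory.IsFiniteKernel κ := ⟨ENNReal.ofReal C, ENNReal.ofReal_lt_top, fun s => by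
    have := S.fin s
    have h2 := S.mass_le s
    change f s univ ≤ _
    rw [← ENNReal.ofReal_toReal (measure_ne_top (f s) univ)]
    exact ENNReal.ofReal_le_ofReal h2⟩
  have := (S.Dg_meas h).stronglyMeasurable.integral_kernel
    (κ := ProbabilityTheory.Kernel.prod κ κ)
  simp only [ProbabilityTheory.Kernel.prod_apply] at this
  exact this

lemma Sol.Ig_ii (S : Sol K γ T C C0 f) {L : ℝ} (hL : 0 ≤ L) {φ : ℝ → ℝ} (h : Lip L φ)
    (h0 : φ 0 = 0) (a b : ℝ) : IntervalIntegrable (fun s => Ig K φ (f s)) volume a b := by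
  refine IntervalIntegrable.mono_fun' (g := fun _ => 2 * L * C0 * (2 * C * C))
    intervalIntegrable_const (S.Ig_meas (h.continuous hL)).aestronglyMeasurable ?_
  exact ae_of_all _ fun s => S.Ig_abs_le hL h h0 s

lemma Sol.phi_int (S : Sol K γ T C C0 f) {L : ℝ} (hL : 0 ≤ L) {φ : ℝ → ℝ} (h : Lip L φ)
    (h0 : φ 0 = 0) (s : ℝ) : Integrable φ (f s) :=
  Integrable.mono' ((S.mom1_int s).const_mul L) (h.continuous hL).aestronglyMeasurable
    (ae_of_all _ fun v => h.abs_le h0 v)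

/-- tent function -/
def tent (L : ℝ) (n : ℕ) (v : ℝ) : ℝ := L * max 0 (min (v - 1 / ((n : ℝ) + 1)) ((n : ℝ) + 1 - v))

lemma tent_lip {L : ℝ} (hL : 0 ≤ L) (n : ℕ) : Lip L (tent L n) := by
  intro x y
  unfold tent
  rw [← mul_sub, abs_mul, abs_of_nonneg hL]
  refine mul_le_mul_of_nonneg_left ?_ hL
  refine (abs_max_sub_max_le_max _ _ _ _).trans ?_
  refine max_le (by simp) ((abs_min_sub_min_le_max _ _ _ _).trans ?_)
  refine max_le (le_of_eq (by congr 1; ring)) (le_of_eq ?_)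
  rw [abs_sub_comm x y]; congr 1; ring

lemma tent_nonneg {L : ℝ} (hL : 0 ≤ L) (n : ℕ) (v : ℝ) : 0 ≤ tent L n v :=
  mul_nonneg hL (le_max_left _ _)

lemma tent_zero {L : ℝ} (n : ℕ) {v : ℝ} (hv : v ∉ Icc (1 / ((n : ℝ) + 1)) ((n : ℝ) + 1)) :
    tent L n v = 0 := by
  unfold tent
  rw [max_eq_left, mul_zero]
  rw [mem_Icc, not_and_or, not_le, not_le] at hv
  rcases hv with hv | hv
  · exact (min_le_left _ _).trans (by linarith)
  · exact (min_le_right _ _).trans (by linarith)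

lemma tent_tendsto (L : ℝ) {v : ℝ} (hv : 0 < v) :
    Tendsto (fun n => tent L n v) atTop (nhds (L * v)) := by
  unfold tent
  have h1 : Tendsto (fun n : ℕ => v - 1 / ((n : ℝ) + 1)) atTop (nhds (v - 0)) :=
    tendsto_const_nhds.sub tendsto_one_div_add_atTop_nhds_zero_nat
  rw [sub_zero] at h1
  have h2 : ∀ᶠ n : ℕ in atTop, max 0 (min (v - 1 / ((n : ℝ) + 1)) ((n : ℝ) + 1 - v)) =
      max 0 (v - 1 / ((n : ℝ) + 1)) := by
    obtain ⟨N, hN⟩ := exists_nat_gt (2 * v)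
    filter_upwards [eventually_ge_atTop N] with n hn
    congr 1
    apply min_eq_left
    have : (N : ℝ) ≤ n := by exact_mod_cast hn
    have : 0 < 1 / ((n : ℝ) + 1) := by positivity
    linarith
  refine Tendsto.const_mul L ?_
  refine Tendsto.congr' (h2.mono fun n h => h.symm) ?_
  have := (tendsto_const_nhds (x := (0 : ℝ))).max h1
  rwa [max_eq_right hv.le] at this

/-- Weak form extended to nonnegative Lipschitz functions vanishing at `0`. -/
lemma Sol.weakLip0 (S : Sol K γ T C C0 f) {L : ℝ} (hL : 0 ≤ L) {φ : ℝ → ℝ} (h : Lip L φ)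
    (h0 : φ 0 = 0) (hpos : ∀ v, 0 ≤ φ v) {t : ℝ} (ht : t ∈ Icc (0 : ℝ) T) :
    (∫ v, φ v ∂(f t)) - (∫ v, φ v ∂(f 0)) =
        (1 / 2) * ∫ s in (0 : ℝ)..t, Ig K φ (f s) := by
  set ψ : ℕ → ℝ → ℝ := fun n v => min (φ v) (tent L n v) with hψ
  have hlip : ∀ n, Lip L (ψ n) := fun n => h.min (tent_lip hL n)
  have hψ0 : ∀ n, ψ n 0 = 0 := fun n => by
    simp only [hψ, h0]; exact min_eq_left (tent_nonneg hL n 0)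
  have hz : ∀ (n : ℕ) (v : ℝ), v ∉ Icc (1 / ((n : ℝ) + 1)) ((n : ℝ) + 1) → ψ n v = 0 := fun n v hv => by
    simp only [hψ, tent_zero n hv]; exact min_eq_right (hpos v)
  have hlim : ∀ v, 0 < v → Tendsto (fun n => ψ n v) atTop (nhds (φ v)) := fun v hv => by
    have h1 := (tendsto_const_nhds (x := φ v)).min (tent_tendsto L hv)
    have h2 := h.abs_le h0 v
    rw [abs_of_pos hv] at h2
    rwa [min_eq_left ((le_abs_self _).trans h2)] at h1
  have hw : ∀ n, (∫ v, ψ n v ∂(f t)) - (∫ v, ψ n v ∂(f 0)) =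
        (1 / 2) * ∫ s in (0 : ℝ)..t, Ig K (ψ n) (f s) := by
    intro n
    have hts : tsupport (ψ n) ⊆ Icc (1 / ((n : ℝ) + 1)) ((n : ℝ) + 1) := by
      apply closure_minimal _ isClosed_Icc
      intro v hv
      by_contra hc
      exact hv (hz n v hc)
    refine S.weak (ψ n) ((hlip n).continuous hL) ?_ ?_ t ht
    · exact IsCompact.of_isClosed_subset isCompact_Icc (isClosed_tsupport _) hts
    · intro v hv
      have := (hts hv).1
      have h3 : 0 < 1 / ((n : ℝ) + 1) := by positivity
      exact lt_of_lt_of_le h3 this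
  have hl1 : ∀ s, Tendsto (fun n => ∫ v, ψ n v ∂(f s)) atTop (nhds (∫ v, φ v ∂(f s))) := by
    intro s
    refine tendsto_integral_of_dominated_convergence (fun v => L * |v|)
      (fun n => ((hlip n).continuous hL).aestronglyMeasurable) ((S.mom1_int s).const_mul L)
      (fun n => ae_of_all _ fun v => (hlip n).abs_le (hψ0 n) v) ?_
    filter_upwards [S.conc s] with v hv using hlim v hv
  have hl2 : ∀ s, Tendsto (fun n => Ig K (ψ n) (f s)) atTop (nhds (Ig K φ (f s))) := by
    intro s
    have := S.fin s
    refine tendsto_integral_of_dominated_convergence (fun p => 2 * L * C0 * domF γ p)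
      (fun n => (S.Dg_meas ((hlip n).continuous hL)).aestronglyMeasurable)
      ((S.domF_int s).const_mul _)
      (fun n => ae_of_all _ fun p => S.Dg_bound hL (hlip n) (hψ0 n) p) ?_
    have a1 : ∀ᵐ p ∂((f s).prod (f s)), 0 < p.1 :=
      Measure.quasiMeasurePreserving_fst.ae (S.conc s)
    have a2 : ∀ᵐ p ∂((f s).prod (f s)), 0 < p.2 :=
      Measure.quasiMeasurePreserving_snd.ae (S.conc s)
    filter_upwards [a1, a2] with p h1 h2
    unfold Dg
    exact (((hlim _ (add_pos h1 h2)).sub (hlim _ h1)).sub (hlim _ h2)).const_mul _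
  have hl3 : Tendsto (fun n => ∫ s in (0 : ℝ)..t, Ig K (ψ n) (f s)) atTop
      (nhds (∫ s in (0 : ℝ)..t, Ig K φ (f s))) := by
    refine intervalIntegral.tendsto_integral_filter_of_dominated_convergence
      (fun _ => 2 * L * C0 * (2 * C * C)) ?_ ?_ intervalIntegrable_const ?_
    · exact Eventually.of_forall fun n =>
        (S.Ig_meas ((hlip n).continuous hL)).aestronglyMeasurable
    · exact Eventually.of_forall fun n => ae_of_all _ fun s _ =>
        S.Ig_abs_le hL (hlip n) (hψ0 n) s
    · exact ae_of_all _ fun s _ => hl2 s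
  have hA := (hl1 t).sub (hl1 0)
  have hB := hl3.const_mul (1 / 2)
  refine tendsto_nhds_unique hA (hB.congr fun n => (hw n).symm)

lemma Sol.weakLip (S : Sol K γ T C C0 f) {L : ℝ} (hL : 0 ≤ L) {φ : ℝ → ℝ} (h : Lip L φ)
    (h0 : φ 0 = 0) (hpos : ∀ v, 0 ≤ φ v) {s t : ℝ} (hs : s ∈ Icc (0 : ℝ) T)
    (ht : t ∈ Icc (0 : ℝ) T) :
    (∫ v, φ v ∂(f t)) - (∫ v, φ v ∂(f s)) =
        (1 / 2) * ∫ u in s..t, Ig K φ (f u) := by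
  have h1 := S.weakLip0 hL h h0 hpos hs
  have h2 := S.weakLip0 hL h h0 hpos ht
  have h3 := intervalIntegral.integral_add_adjacent_intervals (S.Ig_ii hL h h0 0 s)
    (S.Ig_ii hL h h0 s t)
  linarith

lemma Sol.ae_fst (S : Sol K γ T C C0 f) (s : ℝ) : ∀ᵐ p ∂((f s).prod (f s)), 0 < p.1 :=
  haveI := S.fin s
  Measure.quasiMeasurePreserving_fst.ae (S.conc s)

lemma Sol.ae_snd (S : Sol K γ T C C0 f) (s : ℝ) : ∀ᵐ p ∂((f s).prod (f s)), 0 < p.2 :=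
  haveI := S.fin s
  Measure.quasiMeasurePreserving_snd.ae (S.conc s)

lemma Sol.Ig_lower (S : Sol K γ T C C0 f) {L N : ℝ} (hL : 0 ≤ L) {φ : ℝ → ℝ} (h : Lip L φ)
    (h0 : φ 0 = 0) (hpos : ∀ v, 0 ≤ φ v) (hN : 0 ≤ N) (hz : ∀ v, N < v → φ v = 0) (s : ℝ) :
    -(2 * C0 * (N ^ γ * C + C)) * (∫ v, φ v ∂(f s)) ≤ Ig K φ (f s) := by
  have := S.fin s
  have hC0 := S.C0_nonneg
  have hφi := S.phi_int hL h h0 s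
  set B : ℝ → ℝ := fun v => N ^ γ + |v| ^ γ with hB
  have hBi : Integrable B (f s) := (integrable_const _).add (S.momγ_int s)
  have hBle : ∫ v, B v ∂(f s) ≤ N ^ γ * C + C := by
    rw [hB, integral_add (integrable_const _) (S.momγ_int s), integral_const, smul_eq_mul]
    have h1 := S.mass_le s
    have h2 := S.momγ_le s
    have h3 : 0 ≤ N ^ γ := Real.rpow_nonneg hN _
    nlinarith
  have hγ : 0 ≤ γ := by linarith [S.γ_gt]
  have i1 : Integrable (fun p : ℝ × ℝ => φ p.1 * B p.2) ((f s).prod (f s)) := hφi.mul_prod hBi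
  have i2 : Integrable (fun p : ℝ × ℝ => B p.1 * φ p.2) ((f s).prod (f s)) := hBi.mul_prod hφi
  have hkey : ∫ p, -C0 * (φ p.1 * B p.2 + B p.1 * φ p.2) ∂((f s).prod (f s)) ≤ Ig K φ (f s) := by
    refine integral_mono_ae ((i1.add i2).const_mul _) (S.Dg_int hL h h0 s) ?_
    filter_upwards [S.ae_fst s, S.ae_snd s] with p h1 h2
    have hK := S.K_le p
    have hK0 := S.K_nonneg p
    have hb : ∀ a b : ℝ, 0 < a → K p ≤ C0 * (|a| ^ γ + |b| ^ γ) →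
        K p * φ a ≤ C0 * (φ a * B b) := by
      intro a b ha hk
      by_cases haN : N < a
      · simp [hz a haN]
      · rw [not_lt] at haN
        have : |a| ^ γ ≤ N ^ γ := by
          rw [abs_of_pos ha]; exact Real.rpow_le_rpow ha.le haN hγ
        calc K p * φ a ≤ C0 * (|a| ^ γ + |b| ^ γ) * φ a :=
              mul_le_mul_of_nonneg_right hk (hpos a)
          _ ≤ C0 * (N ^ γ + |b| ^ γ) * φ a := by
              have := hpos a
              gcongr
          _ = _ := by simp only [hB]; ring
    have e1 := hb p.1 p.2 h1 hK
    have e2 := hb p.2 p.1 h2 (by rw [add_comm]; exact hK)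
    have e3 := mul_nonneg hK0 (hpos (p.1 + p.2))
    simp only [Dg]
    nlinarith
  rw [integral_const_mul, integral_add i1 i2, integral_prod_mul φ B, integral_prod_mul B φ] at hkey
  refine le_trans ?_ hkey
  have hy : 0 ≤ ∫ v, φ v ∂(f s) := integral_nonneg hpos
  have e := mul_le_mul_of_nonneg_left (mul_le_mul_of_nonneg_left hBle hy) hC0
  linarith

lemma Sol.zero_step (S : Sol K γ T C C0 f) {L N : ℝ} (hL : 0 ≤ L) {φ : ℝ → ℝ} (h : Lip L φ)
    (h0 : φ 0 = 0) (hpos : ∀ v, 0 ≤ φ v) (hN : 0 ≤ N) (hz : ∀ v, N < v → φ v = 0) :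
    ∃ δ : ℝ, 0 < δ ∧ ∀ t ∈ Icc 0 T, (∫ v, φ v ∂(f t)) = 0 →
      ∀ r, 0 ≤ r → r ≤ t → t - δ ≤ r → (∫ v, φ v ∂(f r)) = 0 := by
  set Λ := 2 * C0 * (N ^ γ * C + C) with hΛ
  have hΛ0 : 0 ≤ Λ := by
    have := S.C0_nonneg
    have := S.C_nonneg
    positivity
  refine ⟨1 / (Λ + 1), by positivity, ?_⟩
  intro t ht hyt
  have hY : ∀ r, ∫ v, φ v ∂(f r) ≤ L * C := by
    intro r
    have e1 : ∫ v, φ v ∂(f r) ≤ ∫ v, L * |v| ∂(f r) :=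
      integral_mono (S.phi_int hL h h0 r) ((S.mom1_int r).const_mul L)
        (fun v => (le_abs_self _).trans (h.abs_le h0 v))
    rw [integral_const_mul] at e1
    exact e1.trans (mul_le_mul_of_nonneg_left (S.mom1_le r) hL)
  have hLC : 0 ≤ L * C := mul_nonneg hL S.C_nonneg
  have key : ∀ n : ℕ, ∀ r, 0 ≤ r → r ≤ t → t - 1 / (Λ + 1) ≤ r →
      (∫ v, φ v ∂(f r)) ≤ (L * C) * (1 / 2) ^ n := by
    intro n
    induction n with
    | zero => intro r _ _ _; simpa using hY r
    | succ n ih =>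
      intro r hr0 hrt hr
      have hw := S.weakLip hL h h0 hpos (s := r) (t := t) ⟨hr0, hrt.trans ht.2⟩ ht
      have hm : ∫ u in r..t, (-(Λ * ((L * C) * (1 / 2) ^ n))) ≤ ∫ u in r..t, Ig K φ (f u) := by
        refine intervalIntegral.integral_mono_on hrt intervalIntegrable_const
          (S.Ig_ii hL h h0 r t) ?_
        intro u hu
        have e1 := S.Ig_lower hL h h0 hpos hN hz u
        have e2 := ih u (hr0.trans hu.1) hu.2 (hr.trans hu.1)
        have e3 := mul_le_mul_of_nonneg_left e2 hΛ0
        rw [← hΛ] at e1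
        linarith
      rw [intervalIntegral.integral_const, smul_eq_mul] at hm
      have hd : (t - r) * Λ ≤ 1 := by
        have : t - r ≤ 1 / (Λ + 1) := by linarith
        calc (t - r) * Λ ≤ 1 / (Λ + 1) * Λ := by gcongr
          _ ≤ 1 := by
            rw [one_div, inv_mul_le_iff₀ (by positivity)]; linarith
      have hX : 0 ≤ (L * C) * (1 / 2) ^ n := by positivity
      have := mul_le_mul_of_nonneg_right hd hX
      rw [pow_succ]
      rw [hyt] at hw
      linarith
  intro r hr0 hrt hr
  refine le_antisymm ?_ (integral_nonneg hpos)
  have hlim : Tendsto (fun n : ℕ => (L * C) * (1 / 2 : ℝ) ^ n) atTop (nhds ((L * C) * 0)) :=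
    (tendsto_pow_atTop_nhds_zero_of_lt_one (by norm_num) (by norm_num)).const_mul _
  rw [mul_zero] at hlim
  exact ge_of_tendsto' hlim (fun n => key n r hr0 hrt hr)

lemma Sol.zero_back (S : Sol K γ T C C0 f) {L N : ℝ} (hL : 0 ≤ L) {φ : ℝ → ℝ} (h : Lip L φ)
    (h0 : φ 0 = 0) (hpos : ∀ v, 0 ≤ φ v) (hN : 0 ≤ N) (hz : ∀ v, N < v → φ v = 0)
    {s t : ℝ} (hs : 0 ≤ s) (hst : s ≤ t) (ht : t ≤ T) (hyt : (∫ v, φ v ∂(f t)) = 0) :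
    (∫ v, φ v ∂(f s)) = 0 := by
  obtain ⟨δ, hδ, hstep⟩ := S.zero_step hL h h0 hpos hN hz
  have key : ∀ n : ℕ, ∀ r, 0 ≤ r → r ≤ t → t - n * δ ≤ r → (∫ v, φ v ∂(f r)) = 0 := by
    intro n
    induction n with
    | zero =>
      intro r _ h1 h2
      have : r = t := le_antisymm h1 (by simpa using h2)
      rw [this]; exact hyt
    | succ n ih =>
      intro r h1 h2 h3
      push_cast at h3
      by_cases hr : t - n * δ ≤ r
      · exact ih r h1 h2 hr
      · rw [not_le] at hr
        have e : 0 ≤ n * δ := by positivity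
        exact hstep (t - n * δ) ⟨by linarith, by linarith⟩
          (ih _ (by linarith) (by linarith) le_rfl) r h1 hr.le (by linarith)
  obtain ⟨n, hn⟩ := exists_nat_ge ((t - s) / δ)
  rw [div_le_iff₀ hδ] at hn
  exact key n s hs hst (by linarith)

/-- bump function -/
def bump (x ε v : ℝ) : ℝ := max 0 (ε - |v - x|)

lemma bump_lip (x ε : ℝ) : Lip 1 (bump x ε) := by
  intro a b
  unfold bump
  refine (abs_max_sub_max_le_max _ _ _ _).trans (max_le (by simp) ?_)
  rw [one_mul, sub_sub_sub_cancel_left]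
  refine (abs_abs_sub_abs_le _ _).trans (le_of_eq ?_)
  rw [abs_sub_comm a b]; congr 1; ring

lemma bump_nonneg (x ε v : ℝ) : 0 ≤ bump x ε v := le_max_left _ _

lemma bump_pos_iff {x ε v : ℝ} : 0 < bump x ε v ↔ v ∈ Ioo (x - ε) (x + ε) := by
  unfold bump
  rw [lt_max_iff, mem_Ioo]
  constructor
  · rintro (h | h)
    · exact absurd h (lt_irrefl _)
    · have := abs_lt.1 (show |v - x| < ε by linarith)
      constructor <;> linarith [this.1, this.2]
  · rintro ⟨h1, h2⟩
    right
    have := abs_lt.2 (⟨by linarith, by linarith⟩ : -ε < v - x ∧ v - x < ε)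
    linarith

lemma bump_eq_zero {x ε v : ℝ} (h : v ∉ Ioo (x - ε) (x + ε)) : bump x ε v = 0 :=
  le_antisymm (not_lt.1 fun h' => h (bump_pos_iff.1 h')) (bump_nonneg _ _ _)

lemma bump_integral_zero_iff {μ : Measure ℝ} {x ε : ℝ} (hi : Integrable (bump x ε) μ) :
    (∫ v, bump x ε v ∂μ) = 0 ↔ μ (Ioo (x - ε) (x + ε)) = 0 := by
  rw [integral_eq_zero_iff_of_nonneg (bump_nonneg x ε) hi]
  rw [Filter.EventuallyEq, ae_iff]
  have : {a | ¬ bump x ε a = (0 : ℝ → ℝ) a} = Ioo (x - ε) (x + ε) := by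
    ext v
    rw [mem_ofPred_eq, ← bump_pos_iff, Pi.zero_apply]
    exact (bump_nonneg x ε v).lt_iff_ne'.symm
  rw [this]

/-- topological support, phrased with intervals -/
def InSupp (μ : Measure ℝ) (x : ℝ) : Prop := ∀ ε : ℝ, 0 < ε → μ (Ioo (x - ε) (x + ε)) ≠ 0

lemma InSupp.of_small {μ : Measure ℝ} {x : ℝ} (hx : 0 < x)
    (h : ∀ ε : ℝ, 0 < ε → ε < x → μ (Ioo (x - ε) (x + ε)) ≠ 0) : InSupp μ x := by
  intro ε hε h0
  refine h (min ε (x / 2)) (by positivity) ((min_le_right _ _).trans_lt (by linarith)) ?_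
  refine measure_mono_null (Ioo_subset_Ioo ?_ ?_) h0
  · linarith [min_le_left ε (x / 2)]
  · linarith [min_le_left ε (x / 2)]

lemma Sol.bump_zero_back (S : Sol K γ T C C0 f) {x ε : ℝ} (_hx : 0 < x) (hε : 0 < ε) (hεx : ε < x)
    {s t : ℝ} (hs : 0 ≤ s) (hst : s ≤ t) (ht : t ≤ T) (h : f t (Ioo (x - ε) (x + ε)) = 0) :
    f s (Ioo (x - ε) (x + ε)) = 0 := by
  have hb0 : bump x ε 0 = 0 := bump_eq_zero (fun h => by linarith [h.1])
  have hi := fun r => S.phi_int zero_le_one (bump_lip x ε) hb0 r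
  rw [← bump_integral_zero_iff (hi _)] at h ⊢
  refine S.zero_back zero_le_one (bump_lip x ε) hb0 (bump_nonneg x ε) (N := x + ε)
    (by linarith) (fun v hv => bump_eq_zero fun h' => ?_) hs hst ht h
  linarith [h'.2]

lemma Sol.persist (S : Sol K γ T C C0 f) {x : ℝ} (hx : 0 < x)
    {s t : ℝ} (hs : 0 ≤ s) (hst : s ≤ t) (ht : t ≤ T) (h : InSupp (f s) x) : InSupp (f t) x := by
  refine InSupp.of_small hx fun ε hε hεx h0 => h ε hε ?_
  exact S.bump_zero_back hx hε hεx hs hst ht h0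

lemma Sol.grow (S : Sol K γ T C C0 f) (hKpos : ∀ a b, 0 < a → 0 < b → a ≠ b → 0 < K (a, b))
    {x y : ℝ} (hx : 0 < x) (hy : 0 < y) (hxy : x ≠ y)
    (hX : ∀ t, 0 < t → t ≤ T → InSupp (f t) x) (hY : ∀ t, 0 < t → t ≤ T → InSupp (f t) y) :
    ∀ t, 0 < t → t ≤ T → InSupp (f t) (x + y) := by
  intro t ht0 htT
  refine InSupp.of_small (by linarith) fun ε hε hεx h0 => ?_
  set φ := bump (x + y) ε with hφ
  have hb0 : φ 0 = 0 := bump_eq_zero (fun h => by linarith [h.1])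
  have hzero : ∀ s, 0 ≤ s → s ≤ t → f s (Ioo (x + y - ε) (x + y + ε)) = 0 := fun s hs hst =>
    S.bump_zero_back (by linarith) hε hεx hs hst htT h0
  have hi := fun r => S.phi_int zero_le_one (bump_lip (x + y) ε) hb0 r
  have hI : ∀ s, 0 ≤ s → s ≤ t →
      Dg K φ =ᵐ[(f s).prod (f s)] fun p => K p * φ (p.1 + p.2) := by
    intro s hs hst
    have := S.fin s
    have hae : ∀ᵐ v ∂(f s), φ v = 0 := by
      have : ∀ᵐ v ∂(f s), v ∉ Ioo (x + y - ε) (x + y + ε) :=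
        measure_eq_zero_iff_ae_notMem.1 (hzero s hs hst)
      filter_upwards [this] with v hv using bump_eq_zero hv
    have a1 : ∀ᵐ p ∂((f s).prod (f s)), φ p.1 = 0 :=
      Measure.quasiMeasurePreserving_fst.ae hae
    have a2 : ∀ᵐ p ∂((f s).prod (f s)), φ p.2 = 0 :=
      Measure.quasiMeasurePreserving_snd.ae hae
    filter_upwards [a1, a2] with p h1 h2
    simp [Dg, h1, h2]
  -- the operator is strictly positive at each positive time
  have hIpos : ∀ s, 0 < s → s ≤ t → 0 < Ig K φ (f s) := by
    intro s hs hst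
    have := S.fin s
    have hint : Integrable (fun p : ℝ × ℝ => K p * φ (p.1 + p.2)) ((f s).prod (f s)) :=
      (S.Dg_int zero_le_one (bump_lip (x + y) ε) hb0 s).congr (hI s hs.le hst)
    have hnn : ∀ p : ℝ × ℝ, 0 ≤ K p * φ (p.1 + p.2) := fun p =>
      mul_nonneg (S.K_nonneg p) (bump_nonneg _ _ _)
    unfold Ig
    rw [integral_congr_ae (hI s hs.le hst)]
    refine lt_of_le_of_ne (integral_nonneg hnn) (fun hc => ?_)
    have hc' := (integral_eq_zero_iff_of_nonneg hnn hint).1 hc.symm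
    set δ := min (min (x / 2) (y / 2)) (min (ε / 2) (|x - y| / 2)) with hδ
    have hd : 0 < |x - y| := abs_pos.2 (sub_ne_zero.2 hxy)
    have hδ0 : 0 < δ := by positivity
    have d1 : δ ≤ x / 2 := (min_le_left _ _).trans (min_le_left _ _)
    have d2 : δ ≤ y / 2 := (min_le_left _ _).trans (min_le_right _ _)
    have d3 : δ ≤ ε / 2 := (min_le_right _ _).trans (min_le_left _ _)
    have d4 : δ ≤ |x - y| / 2 := (min_le_right _ _).trans (min_le_right _ _)
    have hnull : ((f s).prod (f s)) (Ioo (x - δ) (x + δ) ×ˢ Ioo (y - δ) (y + δ)) = 0 := by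
      rw [Filter.EventuallyEq, ae_iff] at hc'
      refine measure_mono_null ?_ hc'
      rintro ⟨a, b⟩ ⟨⟨ha1, ha2⟩, ⟨hb1, hb2⟩⟩
      simp only at ha1 ha2 hb1 hb2
      have hab : a ≠ b := by
        rintro rfl
        have : |x - y| < 2 * δ := abs_lt.2 ⟨by linarith, by linarith⟩
        linarith
      have p1 := hKpos a b (by linarith) (by linarith) hab
      have p2 : 0 < φ (a + b) := bump_pos_iff.2 ⟨by linarith, by linarith⟩
      exact (mul_pos p1 p2).ne'
    rw [Measure.prod_prod, mul_eq_zero] at hnull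
    rcases hnull with hn | hn
    · exact hX s hs (hst.trans htT) δ hδ0 hn
    · exact hY s hs (hst.trans htT) δ hδ0 hn
  have hw := S.weakLip zero_le_one (bump_lip (x + y) ε) hb0 (bump_nonneg _ _)
    (s := 0) (t := t) ⟨le_rfl, S.T_pos.le⟩ ⟨ht0.le, htT⟩
  rw [(bump_integral_zero_iff (hi _)).2 (hzero t ht0.le le_rfl),
    (bump_integral_zero_iff (hi _)).2 (hzero 0 le_rfl ht0.le)] at hw
  have hp : 0 < ∫ u in (0 : ℝ)..t, Ig K φ (f u) := by
    refine intervalIntegral.intervalIntegral_pos_of_pos_on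
      (S.Ig_ii zero_le_one (bump_lip (x + y) ε) hb0 0 t) (fun u hu => ?_) ht0
    exact hIpos u hu.1 hu.2.le
  linarith

lemma Sol.unbounded (S : Sol K γ T C C0 f) (hKpos : ∀ a b, 0 < a → 0 < b → a ≠ b → 0 < K (a, b))
    {a b : ℝ} (ha : 0 < a) (hb : 0 < b) (hab : a ≠ b)
    (hA : InSupp (f 0) a) (hB : InSupp (f 0) b) {t : ℝ} (ht0 : 0 < t) (htT : t ≤ T) (R : ℝ) :
    f t (Ici R) ≠ 0 := by
  have key : ∀ n : ℕ, ∀ t, 0 < t → t ≤ T → InSupp (f t) (a + n * b) := by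
    intro n
    induction n with
    | zero => intro t h1 h2; simpa using S.persist ha le_rfl h1.le h2 hA
    | succ n ih =>
      have hne : a + n * b ≠ b := by
        rcases Nat.eq_zero_or_pos n with rfl | hn
        · simpa using hab
        · have : (1 : ℝ) ≤ n := by exact_mod_cast hn
          nlinarith
      have := S.grow hKpos (by positivity) hb hne ih
        (fun t h1 h2 => S.persist hb le_rfl h1.le h2 hB)
      intro t h1 h2
      have e : a + ((n + 1 : ℕ) : ℝ) * b = a + n * b + b := by push_cast; ring
      rw [e]; exact this t h1 h2
  obtain ⟨n, hn⟩ := exists_nat_ge ((R + 1) / b)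
  rw [div_le_iff₀ hb] at hn
  intro h0
  refine key n t ht0 htT 1 one_pos (measure_mono_null ?_ h0)
  intro v hv
  have := hv.1
  rw [mem_Ici]; linarith

/-- weight -/
def wt (l q v : ℝ) : ℝ := Real.exp (-(l * v ^ (-q)))

/-- The static test function `v * exp (-l v^(-q))`. -/
def tst (l q v : ℝ) : ℝ := if 0 < v then v * wt l q v else 0

lemma wt_pos (l q v : ℝ) : 0 < wt l q v := Real.exp_pos _

lemma wt_le_one {l q v : ℝ} (hl : 0 ≤ l) (hv : 0 < v) : wt l q v ≤ 1 := by
  unfold wt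
  rw [Real.exp_le_one_iff]
  have : 0 ≤ v ^ (-q) := Real.rpow_nonneg hv.le _
  have := mul_nonneg hl this
  linarith

lemma wt_mono {l q a b : ℝ} (hl : 0 ≤ l) (hq : 0 ≤ q) (ha : 0 < a) (hab : a ≤ b) :
    wt l q a ≤ wt l q b := by
  unfold wt
  rw [Real.exp_le_exp]
  have := Real.rpow_le_rpow_of_nonpos ha hab (neg_nonpos.2 hq)
  have := mul_le_mul_of_nonneg_left this hl
  linarith

lemma tst_nonneg (l q v : ℝ) : 0 ≤ tst l q v := by
  unfold tst
  split_ifs with h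
  · exact mul_nonneg h.le (wt_pos _ _ _).le
  · exact le_rfl

lemma tst_le_abs {l q : ℝ} (hl : 0 ≤ l) (v : ℝ) : tst l q v ≤ |v| := by
  unfold tst
  split_ifs with h
  · rw [abs_of_pos h]
    exact mul_le_of_le_one_right h.le (wt_le_one hl h)
  · exact abs_nonneg _

lemma tst_lip {l q : ℝ} (hl : 0 ≤ l) (hq : 0 ≤ q) : Lip (1 + q) (tst l q) := by
  have h1 : LipschitzOnWith (Real.toNNReal (1 + q)) (fun v => v * wt l q v) (Ioi 0) := by
    refine (convex_Ioi 0).lipschitzOnWith_of_nnnorm_hasDerivWithin_le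
      (f' := fun v => wt l q v * (1 + q * (l * v ^ (-q)))) ?_ ?_
    · intro v hv
      have hv' : (0 : ℝ) < v := hv
      refine HasDerivAt.hasDerivWithinAt ?_
      have e1 : HasDerivAt (fun v : ℝ => v ^ (-q)) (-q * v ^ (-q - 1)) v :=
        Real.hasDerivAt_rpow_const (Or.inl hv'.ne')
      have e2 := (hasDerivAt_id v).mul ((e1.const_mul l).neg.exp)
      refine e2.congr_deriv ?_
      have : v ^ (-q) = v ^ (-q - 1) * v := by
        rw [← Real.rpow_add_one hv'.ne']; congr 1; ring
      simp only [wt, id]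
      simp only [Pi.neg_apply]
      rw [this]
      ring
    · intro v hv
      have hv' : (0 : ℝ) < v := hv
      rw [← NNReal.coe_le_coe, coe_nnnorm, Real.norm_eq_abs, Real.coe_toNNReal _ (by linarith)]
      have hu : 0 ≤ l * v ^ (-q) := mul_nonneg hl (Real.rpow_nonneg hv'.le _)
      have hw := wt_pos l q v
      rw [abs_of_nonneg (by positivity)]
      have h2 : wt l q v * (l * v ^ (-q)) ≤ 1 := by
        unfold wt
        rw [Real.exp_neg, inv_mul_le_iff₀ (Real.exp_pos _), mul_one]
        linarith [Real.add_one_le_exp (l * v ^ (-q))]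
      have h3 := wt_le_one (q := q) hl hv'
      nlinarith
  have hpp : ∀ x y, 0 < x → 0 < y → |tst l q x - tst l q y| ≤ (1 + q) * |x - y| := by
    intro x y hx hy
    have := h1.dist_le_mul x hx y hy
    rw [Real.dist_eq, Real.dist_eq, Real.coe_toNNReal _ (by linarith)] at this
    simp only [tst, hx, hy, if_true]
    exact this
  have hpn : ∀ x y, 0 < x → y ≤ 0 → |tst l q x - tst l q y| ≤ (1 + q) * |x - y| := by
    intro x y hx hy
    have e : tst l q y = 0 := by simp [tst, not_lt.2 hy]
    rw [e, sub_zero, abs_of_nonneg (tst_nonneg _ _ _), abs_of_nonneg (by linarith)]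
    have := tst_le_abs (q := q) hl x
    rw [abs_of_pos hx] at this
    nlinarith
  intro x y
  rcases lt_or_ge 0 x with hx | hx <;> rcases lt_or_ge 0 y with hy | hy
  · exact hpp x y hx hy
  · exact hpn x y hx hy
  · rw [abs_sub_comm, abs_sub_comm x y]; exact hpn y x hy hx
  · simp only [tst, not_lt.2 hx, not_lt.2 hy, if_false, sub_self, abs_zero]
    positivity

lemma tst_super {l q a b : ℝ} (hl : 0 ≤ l) (hq : 0 ≤ q) (ha : 0 < a) (hb : 0 < b) :
    a * (wt l q (a + b) - wt l q a) ≤ tst l q (a + b) - tst l q a - tst l q b := by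
  simp only [tst, ha, hb, add_pos ha hb, if_true]
  have := wt_mono (b := a + b) hl hq hb (by linarith)
  nlinarith

lemma rpow_diff {q a b : ℝ} (hq : 0 ≤ q) (ha : 0 < a) (hb : 0 < b) :
    q * b * (a + b) ^ (-q - 1) ≤ a ^ (-q) - (a + b) ^ (-q) := by
  have hab : 0 < a + b := by linarith
  set y := b / (a + b) with hy
  have ey : 1 - y = a / (a + b) := by rw [hy]; field_simp; ring
  have hy1 : 0 < 1 - y := by rw [ey]; positivity
  have e1 : a ^ (-q) = (a + b) ^ (-q) * (1 - y) ^ (-q) := by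
    rw [← Real.mul_rpow hab.le hy1.le, ey]
    congr 1; field_simp
  have e2 : 1 + q * y ≤ (1 - y) ^ (-q) := by
    rw [Real.rpow_def_of_pos hy1]
    have h1 := Real.log_le_sub_one_of_pos hy1
    have h2 : q * y ≤ Real.log (1 - y) * -q := by nlinarith
    have h3 := Real.add_one_le_exp (Real.log (1 - y) * -q)
    linarith
  have e3 : (a + b) ^ (-q - 1) = (a + b) ^ (-q) / (a + b) := Real.rpow_sub_one hab.ne' _
  have hp : 0 ≤ (a + b) ^ (-q) := Real.rpow_nonneg hab.le _
  rw [e1, e3]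
  have := mul_le_mul_of_nonneg_left e2 hp
  have e4 : q * b * ((a + b) ^ (-q) / (a + b)) = (a + b) ^ (-q) * (q * y) := by
    rw [hy]; field_simp
  rw [e4]; linarith

lemma wt_diff {l q a b : ℝ} (hl : 0 ≤ l) (hq : 0 ≤ q) (ha : 0 < a) (hb : 0 < b) (hba : b ≤ a) :
    wt l q a * (l * (q * b * (2 * a) ^ (-q - 1))) ≤ wt l q (a + b) - wt l q a := by
  have h1 := rpow_diff hq ha hb
  have h2 : (2 * a) ^ (-q - 1) ≤ (a + b) ^ (-q - 1) :=
    Real.rpow_le_rpow_of_nonpos (by linarith) (by linarith) (by linarith)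
  have h3 : q * b * (2 * a) ^ (-q - 1) ≤ a ^ (-q) - (a + b) ^ (-q) :=
    (mul_le_mul_of_nonneg_left h2 (by positivity)).trans h1
  have h4 := mul_le_mul_of_nonneg_left h3 hl
  have e : wt l q (a + b) = wt l q a * Real.exp (l * (a ^ (-q) - (a + b) ^ (-q))) := by
    unfold wt; rw [← Real.exp_add]; congr 1; ring
  have h5 := Real.add_one_le_exp (l * (a ^ (-q) - (a + b) ^ (-q)))
  rw [e]
  have := wt_pos l q a
  nlinarith

lemma Sol.Dg_tst_nonneg (S : Sol K γ T C C0 f) {l : ℝ} (hl : 0 ≤ l) {p : ℝ × ℝ}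
    (h1 : 0 < p.1) (h2 : 0 < p.2) : 0 ≤ Dg K (tst l (γ - 1)) p := by
  have hq : 0 ≤ γ - 1 := by linarith [S.γ_gt]
  refine mul_nonneg (S.K_nonneg p) (le_trans ?_ (tst_super hl hq h1 h2))
  have := wt_mono (b := p.1 + p.2) hl hq h1 (by linarith)
  exact mul_nonneg h1.le (by linarith)

lemma Sol.Dg_tst_low (S : Sol K γ T C C0 f) {l κ A R : ℝ} (hl : 0 ≤ l) (_hκ : 0 < κ)
    (hK : ∀ a b, A ≤ a → 0 < b → b ≤ R → κ * a ^ γ ≤ K (a, b)) (hA : 0 < A) (hRA : R ≤ A)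
    {p : ℝ × ℝ} (h1 : A ≤ p.1) (h2 : 0 < p.2) (h3 : p.2 ≤ R) :
    κ * (γ - 1) * 2 ^ (-γ) * l * (tst l (γ - 1) p.1 * |p.2|) ≤ Dg K (tst l (γ - 1)) p := by
  obtain ⟨a, b⟩ := p
  simp only at h1 h2 h3
  have ha : 0 < a := by linarith
  have hq : 0 ≤ γ - 1 := by linarith [S.γ_gt]
  have e1 := tst_super hl hq ha h2
  have e2 := wt_diff hl hq ha h2 (by linarith)
  have e3 := hK a b h1 h2 h3
  have e4 : (2 * a) ^ (-(γ - 1) - 1) = 2 ^ (-γ) * a ^ (-γ) := by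
    rw [show -(γ - 1) - 1 = -γ by ring, Real.mul_rpow (by norm_num) ha.le]
  have e5 : a ^ γ * a ^ (-γ) = 1 := by
    rw [← Real.rpow_add ha]; simp
  rw [e4] at e2
  have hw := wt_pos l (γ - 1) a
  have h2g : (0 : ℝ) < 2 ^ (-γ) := by positivity
  have hag : 0 < a ^ γ := by positivity
  have hag' : 0 < a ^ (-γ) := by positivity
  simp only [Dg]
  have e6 : a * (wt l (γ - 1) a * (l * ((γ - 1) * b * (2 ^ (-γ) * a ^ (-γ))))) ≤
      tst l (γ - 1) (a + b) - tst l (γ - 1) a - tst l (γ - 1) b :=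
    (mul_le_mul_of_nonneg_left e2 ha.le).trans e1
  have e7 := mul_le_mul e3 e6 (by positivity) (S.K_nonneg _)
  refine le_trans (le_of_eq ?_) e7
  rw [abs_of_pos h2]
  simp only [tst, ha, if_true]
  calc κ * (γ - 1) * 2 ^ (-γ) * l * (a * wt l (γ - 1) a * b)
      = κ * (γ - 1) * 2 ^ (-γ) * l * (a * wt l (γ - 1) a * b) * (a ^ γ * a ^ (-γ)) := by
        rw [e5, mul_one]
    _ = _ := by ring

lemma Sol.small_mass (S : Sol K γ T C C0 f) {m : ℝ} (hm : 0 < m)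
    (hmass : ∀ t ∈ Icc 0 T, ∫ v, |v| ∂(f t) = m) :
    ∃ R : ℝ, 0 < R ∧ ∀ t ∈ Icc 0 T, m / 2 ≤ ∫ v, (Iic R).indicator (fun v => |v|) v ∂(f t) := by
  have hq : 0 < γ - 1 := by linarith [S.γ_gt]
  have hlim : Tendsto (fun R : ℝ => R ^ (-(γ - 1)) * C) atTop (nhds (0 * C)) :=
    (tendsto_rpow_neg_atTop hq).mul_const C
  rw [zero_mul] at hlim
  obtain ⟨R, hR1, hR0⟩ := ((hlim.eventually (gt_mem_nhds (half_pos hm))).and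
    (eventually_gt_atTop 0)).exists
  refine ⟨R, hR0, fun t ht => ?_⟩
  have hi : Integrable ((Iic R).indicator (fun v : ℝ => |v|)) (f t) :=
    (S.mom1_int t).indicator measurableSet_Iic
  have h1 : ∫ v, |v| ∂(f t) ≤
      ∫ v, ((Iic R).indicator (fun v => |v|) v + R ^ (-(γ - 1)) * |v| ^ γ) ∂(f t) := by
    refine integral_mono_ae (S.mom1_int t) (hi.add ((S.momγ_int t).const_mul _)) ?_
    filter_upwards [S.conc t] with v hv
    have hRp : 0 ≤ R ^ (-(γ - 1)) := Real.rpow_nonneg hR0.le _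
    by_cases h : v ≤ R
    · rw [indicator_of_mem (show v ∈ Iic R from h)]
      have : 0 ≤ R ^ (-(γ - 1)) * |v| ^ γ := by positivity
      linarith
    · rw [indicator_of_notMem (show v ∉ Iic R from h), zero_add, abs_of_pos hv]
      rw [not_le] at h
      have e : v = v ^ (-(γ - 1)) * v ^ γ := by
        rw [← Real.rpow_add hv]; simp
      have e2 : v ^ (-(γ - 1)) ≤ R ^ (-(γ - 1)) :=
        Real.rpow_le_rpow_of_nonpos hR0 h.le (by linarith)
      have e3 := mul_le_mul_of_nonneg_right e2 (Real.rpow_nonneg hv.le γ)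
      linarith
  rw [integral_add hi ((S.momγ_int t).const_mul _), integral_const_mul, hmass t ht] at h1
  have h2 := mul_le_mul_of_nonneg_left (S.momγ_le t) (Real.rpow_nonneg hR0.le (-(γ - 1)))
  linarith

lemma Sol.doubling (S : Sol K γ T C C0 f) {l κ A R m : ℝ} (hl : 0 ≤ l) (hκ : 0 < κ)
    (hK : ∀ a b, A ≤ a → 0 < b → b ≤ R → κ * a ^ γ ≤ K (a, b)) (hA : 0 < A) (hRA : R ≤ A)
    (hm : 0 < m)
    (hmass : ∀ t ∈ Icc 0 T, ∫ v, |v| ∂(f t) = m)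
    (hR : ∀ t ∈ Icc 0 T, m / 2 ≤ ∫ v, (Iic R).indicator (fun v => |v|) v ∂(f t))
    {s t : ℝ} (hs : 0 ≤ s) (hst : s ≤ t) (ht : t ≤ T)
    (hlt : κ * (γ - 1) * 2 ^ (-γ) * l * (m / 4) * (t - s) = 1) :
    2 * ((∫ v, tst l (γ - 1) v ∂(f s)) - wt l (γ - 1) A * m) ≤
      (∫ v, tst l (γ - 1) v ∂(f t)) - wt l (γ - 1) A * m := by
  have hq : 0 < γ - 1 := by linarith [S.γ_gt]
  set q := γ - 1 with hqdef
  set φ := tst l q with hφ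
  have hL : 0 ≤ 1 + q := by linarith
  have hlip : Lip (1 + q) φ := tst_lip hl hq.le
  have h0 : φ 0 = 0 := by simp [hφ, tst]
  have hpos : ∀ v, 0 ≤ φ v := tst_nonneg l q
  have hφi := fun u => S.phi_int hL hlip h0 u
  have hnn : ∀ u, 0 ≤ Ig K φ (f u) := fun u => integral_nonneg_of_ae (by
    filter_upwards [S.ae_fst u, S.ae_snd u] with p h1 h2
    exact S.Dg_tst_nonneg hl h1 h2)
  have hmono : ∀ u ∈ Icc s t, (∫ v, φ v ∂(f s)) ≤ ∫ v, φ v ∂(f u) := by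
    intro u hu
    have hw := S.weakLip hL hlip h0 hpos (s := s) (t := u) ⟨hs, by linarith⟩
      ⟨by linarith [hu.1], by linarith [hu.2]⟩
    have := intervalIntegral.integral_nonneg (μ := volume) hu.1 (fun r _ => hnn r)
    linarith
  set c := κ * q * 2 ^ (-γ) * l with hc
  have hc0 : 0 ≤ c := by positivity
  set z := (∫ v, φ v ∂(f s)) - wt l q A * m with hz
  have hlow : ∀ u ∈ Icc s t, c * (m / 2) * z ≤ Ig K φ (f u) := by
    intro u hu
    have := S.fin u
    have huT : u ∈ Icc 0 T := ⟨hs.trans hu.1, hu.2.trans ht⟩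
    set P : ℝ → ℝ := (Ici A).indicator φ with hP
    set Q : ℝ → ℝ := (Iic R).indicator (fun v => |v|) with hQ
    have hPi : Integrable P (f u) := (hφi u).indicator measurableSet_Ici
    have hQi : Integrable Q (f u) := (S.mom1_int u).indicator measurableSet_Iic
    have hP0 : ∀ v, 0 ≤ P v := indicator_nonneg (fun v _ => hpos v)
    have hIg : ∫ p, c * (P p.1 * Q p.2) ∂((f u).prod (f u)) ≤ Ig K φ (f u) := by
      refine integral_mono_ae ((hPi.mul_prod hQi).const_mul c) (S.Dg_int hL hlip h0 u) ?_
      filter_upwards [S.ae_fst u, S.ae_snd u] with p h1 h2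
      by_cases hp1 : A ≤ p.1
      · by_cases hp2 : p.2 ≤ R
        · simp only [hP, hQ]
          rw [indicator_of_mem (show p.1 ∈ Ici A from hp1),
            indicator_of_mem (show p.2 ∈ Iic R from hp2)]
          exact S.Dg_tst_low hl hκ hK hA hRA hp1 h2 hp2
        · simp only [hQ]
          rw [indicator_of_notMem (show p.2 ∉ Iic R from hp2), mul_zero, mul_zero]
          exact S.Dg_tst_nonneg hl h1 h2
      · simp only [hP]
        rw [indicator_of_notMem (show p.1 ∉ Ici A from hp1), zero_mul, mul_zero]
        exact S.Dg_tst_nonneg hl h1 h2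
    rw [integral_const_mul, integral_prod_mul P Q] at hIg
    have hPlow : z ≤ ∫ v, P v ∂(f u) := by
      have e1 : ∫ v, φ v ∂(f u) ≤ ∫ v, (P v + wt l q A * |v|) ∂(f u) := by
        refine integral_mono_ae (hφi u) (hPi.add ((S.mom1_int u).const_mul _)) ?_
        filter_upwards [S.conc u] with v hv
        have hwA := wt_pos l q A
        by_cases hvA : A ≤ v
        · simp only [hP]
          rw [indicator_of_mem (show v ∈ Ici A from hvA)]
          have : 0 ≤ wt l q A * |v| := by positivity
          linarith
        · simp only [hP]
          rw [indicator_of_notMem (show v ∉ Ici A from hvA), zero_add, abs_of_pos hv]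
          have := wt_mono hl hq.le hv (not_le.1 hvA).le
          simp only [hφ, tst, hv, if_true]
          nlinarith
      rw [integral_add hPi ((S.mom1_int u).const_mul _), integral_const_mul, hmass u huT] at e1
      have := hmono u hu
      linarith
    have hPn : 0 ≤ ∫ v, P v ∂(f u) := integral_nonneg hP0
    have e2 := mul_le_mul_of_nonneg_left (hR u huT) hPn
    have e3 := mul_le_mul_of_nonneg_right hPlow (half_pos hm).le
    have e4 := mul_le_mul_of_nonneg_left (e3.trans e2) hc0
    linarith
  have hw := S.weakLip hL hlip h0 hpos (s := s) (t := t) ⟨hs, by linarith⟩ ⟨by linarith, ht⟩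
  have hm2 : ∫ u in s..t, c * (m / 2) * z ≤ ∫ u in s..t, Ig K φ (f u) :=
    intervalIntegral.integral_mono_on hst intervalIntegrable_const (S.Ig_ii hL hlip h0 s t) hlow
  rw [intervalIntegral.integral_const, smul_eq_mul] at hm2
  have e5 : (t - s) * (c * (m / 2) * z) = 2 * z := by
    calc (t - s) * (c * (m / 2) * z) = 2 * z * (c * (m / 4) * (t - s)) := by ring
      _ = 2 * z := by rw [hlt, mul_one]
  rw [e5] at hm2
  linarith

lemma Sol.contra (S : Sol K γ T C C0 f) {κ H m : ℝ} (hκ : 0 < κ)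
    (hK : ∀ a b, H ≤ a → 0 < b → 4 * b ≤ a → κ * a ^ γ ≤ K (a, b))
    (hm : 0 < m) (hmass : ∀ t ∈ Icc 0 T, ∫ v, |v| ∂(f t) = m)
    (hunb : ∀ B : ℝ, f (T / 2) (Ici B) ≠ 0) : False := by
  have hT := S.T_pos
  have hq : 0 < γ - 1 := by linarith [S.γ_gt]
  obtain ⟨R, hR0, hR⟩ := S.small_mass hm hmass
  set A := max (4 * R) H with hAdef
  have hA4 : 4 * R ≤ A := le_max_left _ _
  have hA : 0 < A := by linarith
  have hK' : ∀ a b, A ≤ a → 0 < b → b ≤ R → κ * a ^ γ ≤ K (a, b) := fun a b h1 h2 h3 =>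
    hK a b ((le_max_right _ _).trans h1) h2 (by linarith)
  set q := γ - 1 with hqdef
  set c := κ * q * 2 ^ (-γ) with hc
  have hc0 : 0 < c := by positivity
  set β := 1 / (c * (m / 4) * (T / 2)) with hβ
  have hβ0 : 0 < β := by positivity
  -- choice of the level
  have hlim : Tendsto (fun B : ℝ => Real.exp (-(β * B ^ (-q)))) atTop (nhds 1) := by
    have h1 : Tendsto (fun B : ℝ => -(β * B ^ (-q))) atTop (nhds (-(β * 0))) :=
      ((tendsto_rpow_neg_atTop hq).const_mul β).neg
    rw [mul_zero, neg_zero] at h1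
    have := (Real.continuous_exp.tendsto 0).comp h1
    rwa [Real.exp_zero] at this
  obtain ⟨B, hB1, hBA⟩ := ((hlim.eventually (lt_mem_nhds (show (1 / 2 : ℝ) < 1 by norm_num))).and
    (eventually_gt_atTop A)).exists
  have hB0 : 0 < B := hA.trans hBA
  have hfin := S.fin (T / 2)
  set N := (f (T / 2)).real (Ici B) with hN
  have hN0 : 0 < N := ENNReal.toReal_pos (hunb B) (measure_ne_top _ _)
  set r := 2 * Real.exp (-(β * B ^ (-q))) with hr
  set ρ := Real.exp (-(β * (A ^ (-q) - B ^ (-q)))) with hρ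
  have hr1 : 1 < r := by rw [hr]; linarith
  have hρ1 : ρ < 1 := by
    rw [hρ, Real.exp_lt_one_iff]
    have : B ^ (-q) < A ^ (-q) := Real.rpow_lt_rpow_of_neg hA hBA (by linarith)
    have := mul_pos hβ0 (sub_pos.2 this)
    linarith
  have hρ0 : 0 ≤ ρ := (Real.exp_pos _).le
  have key : ∀ n : ℕ, 1 ≤ n → r ^ n * (B * N - m * ρ ^ n) ≤ m := by
    intro n hn
    have hn0 : (0 : ℝ) < n := by exact_mod_cast hn
    set l := n * β with hl
    have hl0 : 0 ≤ l := by positivity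
    set z : ℝ → ℝ := fun t => (∫ v, tst l q v ∂(f t)) - wt l q A * m with hz
    have hL : 0 ≤ 1 + q := by linarith
    have hφi := fun u => S.phi_int hL (tst_lip hl0 hq.le) (by simp [tst]) u
    have hstep : ∀ j : ℕ, j ≤ n → 2 ^ j * z (T / 2) ≤ z (T / 2 + j * (T / (2 * n))) := by
      intro j
      induction j with
      | zero => intro _; simp
      | succ j ih =>
        intro hj
        have h1 := ih (by omega)
        have hj' : ((j : ℝ) + 1) ≤ n := by exact_mod_cast hj
        have h2 := S.doubling hl0 hκ hK' hA (by linarith) hm hmass hR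
          (s := T / 2 + j * (T / (2 * n))) (t := T / 2 + ((j + 1 : ℕ) : ℝ) * (T / (2 * n)))
          (by positivity) (by push_cast; nlinarith [show 0 < T / (2 * n) by positivity])
          (by
            push_cast
            have : ((j : ℝ) + 1) * (T / (2 * n)) ≤ n * (T / (2 * n)) := by gcongr
            have e : (n : ℝ) * (T / (2 * n)) = T / 2 := by field_simp
            linarith)
          (by
            push_cast
            rw [← hqdef, ← hc, hl, hβ]
            field_simp
            ring)
        rw [pow_succ]
        simp only [hz] at h1 ⊢
        linarith
    have h1 := hstep n le_rfl
    have e : T / 2 + n * (T / (2 * n)) = T := by field_simp; ring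
    rw [e] at h1
    have h2 : z T ≤ m := by
      have a1 : ∫ v, tst l q v ∂(f T) ≤ ∫ v, |v| ∂(f T) :=
        integral_mono (hφi T) (S.mom1_int T) (fun v => tst_le_abs hl0 v)
      rw [hmass T ⟨hT.le, le_rfl⟩] at a1
      have := mul_pos (wt_pos l q A) hm
      simp only [hz]; linarith
    have h3 : B * wt l q B * N ≤ ∫ v, tst l q v ∂(f (T / 2)) := by
      have a1 : ∫ v, (Ici B).indicator (fun _ => B * wt l q B) v ∂(f (T / 2)) ≤
          ∫ v, tst l q v ∂(f (T / 2)) := by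
        refine integral_mono ((integrable_const _).indicator measurableSet_Ici) (hφi _) ?_
        intro v
        by_cases hv : B ≤ v
        · rw [indicator_of_mem (show v ∈ Ici B from hv)]
          have hv0 : 0 < v := hB0.trans_le hv
          simp only [tst, hv0, if_true]
          exact mul_le_mul hv (wt_mono hl0 hq.le hB0 hv) (wt_pos _ _ _).le hv0.le
        · rw [indicator_of_notMem (show v ∉ Ici B from hv)]
          exact tst_nonneg _ _ _
      rw [integral_indicator_const _ measurableSet_Ici, smul_eq_mul] at a1
      linarith
    have eB : wt l q B = Real.exp (-(β * B ^ (-q))) ^ n := by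
      rw [← Real.exp_nat_mul, wt, hl]; congr 1; ring
    have eA : wt l q A = Real.exp (-(β * B ^ (-q))) ^ n * ρ ^ n := by
      rw [hρ, ← Real.exp_nat_mul, ← Real.exp_nat_mul, ← Real.exp_add, wt, hl]; congr 1; ring
    have h4 : r ^ n * (B * N - m * ρ ^ n) = 2 ^ n * (B * wt l q B * N - wt l q A * m) := by
      rw [eA, eB, hr, mul_pow]; ring
    rw [h4]
    refine le_trans ?_ (h1.trans h2)
    refine mul_le_mul_of_nonneg_left ?_ (by positivity)
    simp only [hz]; linarith
  have hl1 : Tendsto (fun n : ℕ => B * N - m * ρ ^ n) atTop (nhds (B * N - m * 0)) :=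
    tendsto_const_nhds.sub ((tendsto_pow_atTop_nhds_zero_of_lt_one hρ0 hρ1).const_mul m)
  rw [mul_zero, sub_zero] at hl1
  have hl2 := (tendsto_pow_atTop_atTop_of_one_lt hr1).atTop_mul_pos (mul_pos hB0 hN0) hl1
  obtain ⟨n, hn1, hn2⟩ := ((hl2.eventually (eventually_gt_atTop m)).and
    (eventually_ge_atTop 1)).exists
  exact absurd (key n hn2) (not_le.2 hn1)

end SolLemmas

/-- The kernel restricted to the open quadrant. -/
def Kq (K : ℝ → ℝ → ℝ) : ℝ × ℝ → ℝ :=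
  (Ioi (0 : ℝ) ×ˢ Ioi (0 : ℝ)).indicator (fun p => K p.1 p.2)

lemma Kq_of_pos (K : ℝ → ℝ → ℝ) {a b : ℝ} (ha : 0 < a) (hb : 0 < b) : Kq K (a, b) = K a b :=
  indicator_of_mem (show (a, b) ∈ Ioi (0 : ℝ) ×ˢ Ioi (0 : ℝ) from ⟨ha, hb⟩) _

lemma frac_mem {a b : ℝ} (ha : 0 < a) (hb : 0 < b) : a / (a + b) ∈ Icc (0 : ℝ) 1 :=
  ⟨by positivity, by rw [div_le_one (by linarith)]; linarith⟩

section KernelLemmas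

variable {K h : ℝ → ℝ → ℝ} {g : ℝ → ℝ} {γ H H₀ H₁ G₀ G₁ k : ℝ}

lemma Kq_meas (hK : KernelAssumptionA K h g γ H H₀ H₁ G₀ G₁ k) : Measurable (Kq K) := by
  have hc : ContinuousOn (fun p : ℝ × ℝ => h p.1 p.2 * g (p.1 / (p.1 + p.2)))
      (Ioi (0 : ℝ) ×ˢ Ioi (0 : ℝ)) := by
    refine ContinuousOn.mul (hK.h_cont.mono ?_) ?_
    · rintro ⟨a, b⟩ ⟨ha, hb⟩
      exact ⟨le_of_lt (show (0 : ℝ) < a from ha), le_of_lt (show (0 : ℝ) < b from hb)⟩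
    · refine hK.g_cont.comp (t := Icc 0 1) ?_ ?_
      · refine ContinuousOn.div continuousOn_fst (continuousOn_fst.add continuousOn_snd) ?_
        rintro ⟨a, b⟩ ⟨ha, hb⟩
        have := add_pos (show 0 < a from ha) (show 0 < b from hb)
        exact this.ne'
      · rintro ⟨a, b⟩ ⟨ha, hb⟩
        exact frac_mem ha hb
  have hc' : ContinuousOn (fun p : ℝ × ℝ => K p.1 p.2) (Ioi (0 : ℝ) ×ˢ Ioi (0 : ℝ)) := by
    refine hc.congr ?_
    rintro ⟨a, b⟩ ⟨ha, hb⟩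
    exact hK.K_eq a b (le_of_lt ha) (le_of_lt hb) (add_pos ha hb)
  classical
  have hm := hc'.measurable_piecewise (g := fun _ => (0 : ℝ)) continuousOn_const
    (measurableSet_Ioi.prod measurableSet_Ioi)
  unfold Kq
  rw [← piecewise_eq_indicator]
  exact hm

lemma Kq_nonneg (hK : KernelAssumptionA K h g γ H H₀ H₁ G₀ G₁ k) (p : ℝ × ℝ) : 0 ≤ Kq K p := by
  refine indicator_nonneg ?_ p
  rintro ⟨a, b⟩ ⟨ha, hb⟩
  exact hK.K_nonneg a b (le_of_lt ha) (le_of_lt hb)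

lemma g_nonneg (hK : KernelAssumptionA K h g γ H H₀ H₁ G₀ G₁ k) {x : ℝ} (hx : x ∈ Icc (0 : ℝ) 1) :
    0 ≤ g x := by
  refine le_trans ?_ (hK.g_lower x hx)
  have := hK.G₀_pos
  positivity

lemma Kq_le (hK : KernelAssumptionA K h g γ H H₀ H₁ G₀ G₁ k) (p : ℝ × ℝ) :
    Kq K p ≤ H₁ * G₁ * (|p.1| ^ γ + |p.2| ^ γ) := by
  have hH := hK.H₁_pos
  have hG := hK.G₁_pos
  obtain ⟨a, b⟩ := p
  by_cases hp : (a, b) ∈ Ioi (0 : ℝ) ×ˢ Ioi (0 : ℝ)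
  · have ha : 0 < a := hp.1
    have hb : 0 < b := hp.2
    rw [Kq_of_pos K ha hb, hK.K_eq a b ha.le hb.le (add_pos ha hb)]
    simp only [abs_of_pos ha, abs_of_pos hb]
    have hx := frac_mem ha hb
    have h1 := mul_le_mul_of_nonneg_right (hK.h_upper a b ha.le hb.le) (g_nonneg hK hx)
    have h2 : 0 ≤ H₁ * (a ^ γ + b ^ γ) := by positivity
    have h3 := mul_le_mul_of_nonneg_left (hK.g_upper _ hx) h2
    linarith
  · unfold Kq
    rw [indicator_of_notMem hp]
    positivity

lemma K_pos_offdiag (hK : KernelAssumptionA K h g γ H H₀ H₁ G₀ G₁ k) (a b : ℝ) (ha : 0 < a)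
    (hb : 0 < b) (hab : a ≠ b) : 0 < Kq K (a, b) := by
  rw [Kq_of_pos K ha hb, hK.K_eq a b ha.le hb.le (add_pos ha hb)]
  refine mul_pos ?_ ?_
  · set R := max (max a b) (max (1 / a) (1 / b)) with hR
    have r1 : a ≤ R := (le_max_left _ _).trans (le_max_left _ _)
    have r2 : b ≤ R := (le_max_right _ _).trans (le_max_left _ _)
    have r3 : 1 / a ≤ R := (le_max_left _ _).trans (le_max_right _ _)
    have r4 : 1 / b ≤ R := (le_max_right _ _).trans (le_max_right _ _)
    have hR0 : 0 < R := ha.trans_le r1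
    obtain ⟨c, hc, hcl⟩ := hK.h_posOn R hR0
    refine hc.trans_le (hcl a ⟨?_, r1⟩ b ⟨?_, r2⟩)
    · exact (one_div_le ha hR0).1 r3
    · exact (one_div_le hb hR0).1 r4
  · refine lt_of_lt_of_le ?_ (hK.g_lower _ (frac_mem ha hb))
    refine mul_pos hK.G₀_pos (Real.rpow_pos_of_pos (abs_pos.2 ?_) _)
    intro hc
    apply hab
    have hs : a + b ≠ 0 := (add_pos ha hb).ne'
    field_simp at hc
    linarith

lemma K_low (hK : KernelAssumptionA K h g γ H H₀ H₁ G₀ G₁ k) :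
    ∀ a b, H ≤ a → 0 < b → 4 * b ≤ a → H₀ * (G₀ * (1 / 4) ^ k) * a ^ γ ≤ Kq K (a, b) := by
  intro a b ha hb hab
  have ha0 : 0 < a := by linarith [hK.H_gt_one]
  rw [Kq_of_pos K ha0 hb, hK.K_eq a b ha0.le hb.le (add_pos ha0 hb)]
  have hG := hK.G₀_pos
  have hH := hK.H₀_pos
  have h1 : H₀ * a ^ γ ≤ h a b := by
    refine le_trans ?_ (hK.h_lower a b ha0.le hb.le (by linarith))
    have : 0 ≤ b ^ γ := Real.rpow_nonneg hb.le _
    nlinarith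
  have h2 : G₀ * (1 / 4) ^ k ≤ g (a / (a + b)) := by
    refine le_trans ?_ (hK.g_lower _ (frac_mem ha0 hb))
    refine mul_le_mul_of_nonneg_left ?_ hG.le
    refine Real.rpow_le_rpow (by norm_num) ?_ (by linarith [hK.k_ge_one])
    have : 3 / 4 ≤ a / (a + b) := by
      rw [le_div_iff₀ (by linarith)]; linarith
    exact le_trans (by linarith) (le_abs_self _)
  have h3 : 0 < a ^ γ := Real.rpow_pos_of_pos ha0 _
  have := mul_le_mul h1 h2 (by positivity) (le_trans (by positivity) h1)
  linarith

end KernelLemmas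

/-- ramp functions approximating the indicator of `Ioi a` -/
def ramp (a : ℝ) (n : ℕ) (v : ℝ) : ℝ := max 0 (min 1 (n * (v - a)))

lemma ramp_bound (a : ℝ) (n : ℕ) (v : ℝ) : |ramp a n v| ≤ 1 := by
  unfold ramp
  rw [abs_of_nonneg (le_max_left _ _)]
  exact max_le zero_le_one (min_le_left _ _)

lemma ramp_cont (a : ℝ) (n : ℕ) : Continuous (ramp a n) := by
  unfold ramp; fun_prop

lemma ramp_tendsto (a v : ℝ) :
    Tendsto (fun n => ramp a n v) atTop (nhds ((Ioi a).indicator (fun _ => (1 : ℝ)) v)) := by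
  by_cases hv : a < v
  · rw [indicator_of_mem (show v ∈ Ioi a from hv)]
    refine tendsto_const_nhds.congr' ?_
    obtain ⟨N, hN⟩ := exists_nat_ge (1 / (v - a))
    filter_upwards [eventually_ge_atTop N] with n hn
    have hva : 0 < v - a := by linarith
    have : (N : ℝ) ≤ n := by exact_mod_cast hn
    have h1 : 1 ≤ (n : ℝ) * (v - a) := by
      rw [div_le_iff₀ hva] at hN
      nlinarith
    unfold ramp
    rw [min_eq_left h1, max_eq_right zero_le_one]
  · rw [indicator_of_notMem (show v ∉ Ioi a from hv)]
    refine tendsto_const_nhds.congr' (Eventually.of_forall fun n => ?_)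
    have h1 : (n : ℝ) * (v - a) ≤ 0 :=
      mul_nonpos_of_nonneg_of_nonpos (by positivity) (by linarith)
    change 0 = ramp a n v
    unfold ramp
    rw [max_eq_left ((min_le_right _ _).trans h1)]

lemma meas_family {T : ℝ} {F : ℝ → Measure ℝ} (hfin : ∀ s, IsFiniteMeasure (F s))
    (hz : ∀ s, s ∉ Icc 0 T → F s = 0)
    (hc : ∀ φ : ℝ → ℝ, Continuous φ → (∃ M : ℝ, ∀ v, |φ v| ≤ M) →
      ContinuousOn (fun t => ∫ v, φ v ∂(F t)) (Icc (0 : ℝ) T)) : Measurable F := by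
  have hm : ∀ φ : ℝ → ℝ, Continuous φ → (∃ M : ℝ, ∀ v, |φ v| ≤ M) →
      Measurable (fun t => ∫ v, φ v ∂(F t)) := by
    intro φ h1 h2
    classical
    have := (hc φ h1 h2).measurable_piecewise (g := fun _ => (0 : ℝ)) continuousOn_const
      measurableSet_Icc
    convert this using 1
    ext s
    by_cases hs : s ∈ Icc 0 T
    · rw [piecewise_eq_of_mem _ _ _ hs]
    · rw [piecewise_eq_of_notMem _ _ _ hs, hz s hs, integral_zero_measure]
  have hreal : ∀ A : Set ℝ, Measurable (fun s => (F s).real A) → Measurable (fun s => F s A) := by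
    intro A hA
    have : (fun s => F s A) = fun s => ENNReal.ofReal ((F s).real A) := by
      ext s; exact (ofReal_measureReal).symm
    rw [this]; exact hA.ennreal_ofReal
  refine Measurable.measure_of_isPiSystem (S := range Ioi)
    ((BorelSpace.measurable_eq).trans (borel_eq_generateFrom_Ioi ℝ)) isPiSystem_Ioi ?_ ?_
  · rintro _ ⟨a, rfl⟩
    apply hreal
    refine measurable_of_tendsto_metrizable
      (fun n => hm (ramp a n) (ramp_cont a n) ⟨1, ramp_bound a n⟩) ?_
    rw [tendsto_pi_nhds]
    intro s
    have h1 := tendsto_integral_of_dominated_convergence (μ := F s) (fun _ => (1 : ℝ))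
      (fun n => (ramp_cont a n).aestronglyMeasurable) (integrable_const _)
      (fun n => ae_of_all _ fun v => ramp_bound a n v)
      (ae_of_all _ fun v => ramp_tendsto a v)
    rw [integral_indicator_const _ measurableSet_Ioi, smul_eq_mul, mul_one] at h1
    exact h1
  · apply hreal
    have := hm (fun _ => 1) continuous_const ⟨1, fun _ => by simp⟩
    simpa using this

lemma two_supp {μ : Measure ℝ} [IsFiniteMeasure μ] (hconc : μ (Iic 0) = 0) (hne : μ ≠ 0)
    (hd : ¬ IsSingleDirac μ) :
    ∃ a b : ℝ, 0 < a ∧ 0 < b ∧ a ≠ b ∧ InSupp μ a ∧ InSupp μ b := by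
  have hS : ∀ x, x ∈ μ.support → InSupp μ x := by
    intro x hx ε hε h0
    rw [Measure.mem_support_iff] at hx
    apply hx
    rw [eventually_smallSets]
    exact ⟨Ioo (x - ε) (x + ε), Ioo_mem_nhds (by linarith) (by linarith),
      fun t ht => by simpa using measure_mono_null ht h0⟩
  have hcompl : μ (μ.support)ᶜ = 0 := Measure.measure_compl_support
  have hex : ∃ a ∈ μ.support, 0 < a := by
    by_contra hc
    push Not at hc
    apply hne
    rw [← Measure.measure_univ_eq_zero]
    refine measure_mono_null (t := Iic 0 ∪ (μ.support)ᶜ) ?_ (measure_union_null hconc hcompl)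
    intro v _
    by_cases hv : v ∈ μ.support
    · exact Or.inl (hc v hv)
    · exact Or.inr hv
  obtain ⟨a, ha, ha0⟩ := hex
  by_contra hcon
  have hone : ∀ b ∈ μ.support, 0 < b → b = a := by
    intro b hb hb0
    by_contra hba
    exact hcon ⟨a, b, ha0, hb0, fun h => hba h.symm, hS a ha, hS b hb⟩
  have hnull : μ {a}ᶜ = 0 := by
    refine measure_mono_null (t := Iic 0 ∪ (μ.support)ᶜ) ?_ (measure_union_null hconc hcompl)
    intro v hv
    by_cases hv' : v ∈ μ.support
    · left
      rw [mem_Iic]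
      by_contra hc
      exact hv (hone v hv' (not_le.1 hc))
    · exact Or.inr hv'
  have heq : μ = μ {a} • Measure.dirac a := by
    rw [← Measure.restrict_singleton]
    rw [Measure.restrict_eq_self_of_ae_mem]
    exact measure_eq_zero_iff_ae_notMem.1 hnull |>.mono fun v hv => by simpa using hv
  have hpos : μ {a} ≠ 0 := by
    intro h0
    rw [h0, zero_smul] at heq
    exact hne heq
  refine hd ⟨(μ {a}).toReal, a, ENNReal.toReal_pos hpos (measure_ne_top _ _), ha0, ?_⟩
  rw [ENNReal.ofReal_toReal (measure_ne_top _ _)]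
  exact heq

lemma ae_pos_of_conc {μ : Measure ℝ} (h : μ (Iic 0) = 0) : ∀ᵐ v ∂μ, 0 < v :=
  (measure_eq_zero_iff_ae_notMem.1 h).mono fun v hv => by simpa using hv

/-- All moment facts for one measure. -/
lemma moments {μ : Measure ℝ} {γ : ℝ} (hγ : 1 < γ) (hc : μ (Iic 0) = 0)
    (hi : Integrable (fun v => 1 + v ^ γ) μ) :
    IsFiniteMeasure μ ∧ Integrable (fun v => |v| ^ γ) μ ∧ Integrable (fun v : ℝ => |v|) μ ∧
      μ.real univ ≤ ∫ v, (1 + v ^ γ) ∂μ ∧ (∫ v, |v| ^ γ ∂μ) ≤ ∫ v, (1 + v ^ γ) ∂μ ∧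
      (∫ v, |v| ∂μ) ≤ ∫ v, (1 + v ^ γ) ∂μ := by
  have hp := ae_pos_of_conc hc
  have hcmp : ∀ v : ℝ, 0 < v → v ≤ 1 + v ^ γ := by
    intro v hv
    have h0 := Real.rpow_nonneg hv.le γ
    rcases le_total v 1 with h | h
    · linarith
    · have := Real.rpow_le_rpow_of_exponent_le h hγ.le
      rw [Real.rpow_one] at this
      linarith
  have i1 : Integrable (fun _ : ℝ => (1 : ℝ)) μ := by
    refine hi.mono' aestronglyMeasurable_const ?_
    filter_upwards [hp] with v hv
    have := Real.rpow_nonneg hv.le γ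
    rw [norm_one]; linarith
  have hfin : IsFiniteMeasure μ := by
    rcases integrable_const_iff.1 i1 with h | h
    · norm_num at h
    · exact h
  have i2 : Integrable (fun v : ℝ => |v| ^ γ) μ := by
    refine hi.mono' (Measurable.aestronglyMeasurable (by fun_prop)) ?_
    filter_upwards [hp] with v hv
    have := Real.rpow_nonneg hv.le γ
    rw [abs_of_pos hv, Real.norm_of_nonneg this]; linarith
  have i3 : Integrable (fun v : ℝ => |v|) μ := by
    refine hi.mono' (by fun_prop) ?_
    filter_upwards [hp] with v hv
    rw [abs_of_pos hv, Real.norm_of_nonneg hv.le]; exact hcmp v hv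
  refine ⟨hfin, i2, i3, ?_, ?_, ?_⟩
  · have : μ.real univ = ∫ _, (1 : ℝ) ∂μ := by simp
    rw [this]
    refine integral_mono_ae i1 hi ?_
    filter_upwards [hp] with v hv
    have := Real.rpow_nonneg hv.le γ
    linarith
  · refine integral_mono_ae i2 hi ?_
    filter_upwards [hp] with v hv
    rw [abs_of_pos hv]; linarith
  · refine integral_mono_ae i3 hi ?_
    filter_upwards [hp] with v hv
    rw [abs_of_pos hv]; exact hcmp v hv

lemma iterated_eq {K h : ℝ → ℝ → ℝ} {g : ℝ → ℝ} {γ H H₀ H₁ G₀ G₁ k : ℝ}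
    (hK : KernelAssumptionA K h g γ H H₀ H₁ G₀ G₁ k) {μ : Measure ℝ} [IsFiniteMeasure μ]
    (hc : μ (Iic 0) = 0) (hi : Integrable (fun v => |v| ^ γ) μ) {φ : ℝ → ℝ} (hφ : Continuous φ)
    (hcs : HasCompactSupport φ) :
    (∫ v, (∫ v', K v v' * (φ (v + v') - φ v - φ v') ∂μ) ∂μ) = Ig (Kq K) φ μ := by
  have hp := ae_pos_of_conc hc
  obtain ⟨M, hM⟩ := hcs.exists_bound_of_continuous hφ
  have hM' : ∀ v, |φ v| ≤ M := hM
  have hM0 : 0 ≤ M := (abs_nonneg _).trans (hM' 0)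
  have hH := hK.H₁_pos
  have hG := hK.G₁_pos
  have hmeas : Measurable (Dg (Kq K) φ) := by
    have := Kq_meas hK
    have := hφ.measurable
    unfold Dg
    fun_prop
  have i1 : Integrable (fun p : ℝ × ℝ => |p.1| ^ γ + |p.2| ^ γ) (μ.prod μ) := by
    have a := hi.mul_prod (integrable_const (1 : ℝ) (μ := μ))
    have b := (integrable_const (1 : ℝ) (μ := μ)).mul_prod hi
    simp only [mul_one, one_mul] at a b
    exact a.add b
  have hint : Integrable (Dg (Kq K) φ) (μ.prod μ) := by
    refine (i1.const_mul (3 * M * (H₁ * G₁))).mono' hmeas.aestronglyMeasurable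
      (ae_of_all _ fun p => ?_)
    have h1 := Kq_le hK p
    have h2 := Kq_nonneg hK p
    have h3 : |φ (p.1 + p.2) - φ p.1 - φ p.2| ≤ 3 * M := by
      have a1 := abs_sub (φ (p.1 + p.2) - φ p.1) (φ p.2)
      have a2 := abs_sub (φ (p.1 + p.2)) (φ p.1)
      linarith [hM' (p.1 + p.2), hM' p.1, hM' p.2]
    rw [Real.norm_eq_abs]
    unfold Dg
    rw [abs_mul, abs_of_nonneg h2]
    have := mul_le_mul h1 h3 (abs_nonneg _) (h2.trans h1)
    linarith
  unfold Ig
  rw [integral_prod _ hint]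
  refine integral_congr_ae ?_
  filter_upwards [hp] with v hv
  refine integral_congr_ae ?_
  filter_upwards [hp] with v' hv'
  simp only [Dg, Kq_of_pos K hv hv']

/-- Instantaneous gelation: if `K` satisfies Assumption A and the
initial datum is a nonzero Radon measure on `(0,∞)` with finite `γ`-moment and finite
mass which is not a single Dirac measure, then for every `T > 0` there is no
mass-conserving weak solution on `[0,T]`. -/
theorem no_mass_conserving_solution
    (K h : ℝ → ℝ → ℝ) (g : ℝ → ℝ) (γ H H₀ H₁ G₀ G₁ k : ℝ)
    (hK : KernelAssumptionA K h g γ H H₀ H₁ G₀ G₁ k)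
    (fin : Measure ℝ) (hconc : fin (Iic 0) = 0) (hne : fin ≠ 0)
    (hγmom : Integrable (fun v => 1 + v ^ γ) fin)
    (hmass : Integrable (fun v => v) fin)
    (hdirac : ¬ IsSingleDirac fin) :
    ∀ T : ℝ, 0 < T →
      ¬ ∃ f : ℝ → Measure ℝ, IsWeakSolution K γ T f fin ∧ IsMassConserving T f fin := by

  rintro T hT ⟨f, hw, -, hmc⟩
  have hγ := hK.γ_gt_one
  obtain ⟨C, hC⟩ := hw.moment_bound
  have hmom := fun t (ht : t ∈ Icc (0 : ℝ) T) => moments hγ (hw.conc t ht) (hC t ht).1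
  have h0T : (0 : ℝ) ∈ Icc (0 : ℝ) T := ⟨le_rfl, hT.le⟩
  have hC0 : 0 ≤ C :=
    measureReal_nonneg.trans ((hmom 0 h0T).2.2.2.1.trans (hC 0 h0T).2)
  obtain ⟨finfin, -⟩ := moments hγ hconc hγmom
  classical
  set F : ℝ → Measure ℝ := fun s => if s ∈ Icc (0 : ℝ) T then f s else 0 with hF
  have hFin : ∀ s ∈ Icc (0 : ℝ) T, F s = f s := fun s hs => by simp only [hF, if_pos hs]
  have hFout : ∀ s, s ∉ Icc (0 : ℝ) T → F s = 0 := fun s hs => by simp only [hF, if_neg hs]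
  have hFfin : ∀ s, IsFiniteMeasure (F s) := by
    intro s
    by_cases hs : s ∈ Icc (0 : ℝ) T
    · rw [hFin s hs]; exact (hmom s hs).1
    · rw [hFout s hs]; infer_instance
  have hw0 : ∀ φ : ℝ → ℝ, Continuous φ → HasCompactSupport φ → tsupport φ ⊆ Ioi 0 →
      (∫ v, φ v ∂(f 0)) = ∫ v, φ v ∂fin := by
    intro φ h1 h2 h3
    have := hw.weak_form φ h1 h2 h3 0 h0T
    rw [intervalIntegral.integral_same] at this
    linarith
  have S : Sol (Kq K) γ T C (H₁ * G₁) F := by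
    refine ⟨hT, hγ, hC0, (mul_pos hK.H₁_pos hK.G₁_pos).le, Kq_meas hK, Kq_nonneg hK, Kq_le hK,
      hFfin, ?_, ?_, ?_, ?_, ?_, ?_, ?_, ?_⟩
    · intro s
      by_cases hs : s ∈ Icc (0 : ℝ) T
      · rw [hFin s hs]; exact ae_pos_of_conc (hw.conc s hs)
      · rw [hFout s hs]; simp
    · refine meas_family hFfin hFout fun φ h1 h2 => ?_
      refine (hw.time_cont φ h1 h2).congr fun t ht => ?_
      simp only [hFin t ht]
    · intro s
      by_cases hs : s ∈ Icc (0 : ℝ) T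
      · rw [hFin s hs]; exact (hmom s hs).2.1
      · rw [hFout s hs]; exact integrable_zero_measure
    · intro s
      by_cases hs : s ∈ Icc (0 : ℝ) T
      · rw [hFin s hs]; exact (hmom s hs).2.2.1
      · rw [hFout s hs]; exact integrable_zero_measure
    · intro s
      by_cases hs : s ∈ Icc (0 : ℝ) T
      · rw [hFin s hs]; exact (hmom s hs).2.2.2.1.trans (hC s hs).2
      · rw [hFout s hs]; simpa using hC0
    · intro s
      by_cases hs : s ∈ Icc (0 : ℝ) T
      · rw [hFin s hs]; exact (hmom s hs).2.2.2.2.1.trans (hC s hs).2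
      · rw [hFout s hs]; simpa using hC0
    · intro s
      by_cases hs : s ∈ Icc (0 : ℝ) T
      · rw [hFin s hs]; exact (hmom s hs).2.2.2.2.2.trans (hC s hs).2
      · rw [hFout s hs]; simpa using hC0
    · intro φ h1 h2 h3 t ht
      rw [hFin t ht, hFin 0 h0T, hw0 φ h1 h2 h3, hw.weak_form φ h1 h2 h3 t ht]
      congr 1
      refine intervalIntegral.integral_congr fun s hs => ?_
      rw [uIcc_of_le ht.1] at hs
      have hs' : s ∈ Icc (0 : ℝ) T := ⟨hs.1, hs.2.trans ht.2⟩
      have := (hmom s hs').1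
      simp only [hFin s hs']
      exact iterated_eq hK (hw.conc s hs') (hmom s hs').2.1 h1 h2
  -- support of the initial datum
  obtain ⟨a, b, ha, hb, hab, hsa, hsb⟩ := two_supp hconc hne hdirac
  have htrans : ∀ x, 0 < x → InSupp fin x → InSupp (F 0) x := by
    intro x hx hs
    refine InSupp.of_small hx fun ε hε hεx hzero => hs ε hε ?_
    have hts : tsupport (bump x ε) ⊆ Icc (x - ε) (x + ε) := by
      apply closure_minimal _ isClosed_Icc
      intro v hv
      by_contra hc
      exact hv (bump_eq_zero fun h' => hc ⟨h'.1.le, h'.2.le⟩)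
    have hcont := (bump_lip x ε).continuous zero_le_one
    have hcs : HasCompactSupport (bump x ε) :=
      IsCompact.of_isClosed_subset isCompact_Icc (isClosed_tsupport _) hts
    have he := hw0 (bump x ε) hcont hcs (fun v hv => by
      have := (hts hv).1
      rw [mem_Ioi]; linarith)
    have hf0 := (hmom 0 h0T).1
    rw [hFin 0 h0T] at hzero
    rw [← bump_integral_zero_iff (hcont.integrable_of_hasCompactSupport hcs)] at hzero ⊢
    rw [← he, hzero]
  have hunb : ∀ B : ℝ, F (T / 2) (Ici B) ≠ 0 := fun B =>
    S.unbounded (K_pos_offdiag hK) ha hb hab (htrans a ha hsa) (htrans b hb hsb)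
      (by linarith) (by linarith) B
  -- mass
  have hpfin := ae_pos_of_conc hconc
  have hm : 0 < ∫ v, v ∂fin := by
    have hnn : 0 ≤ᵐ[fin] fun v : ℝ => v := hpfin.mono fun v hv => hv.le
    refine lt_of_le_of_ne (integral_nonneg_of_ae hnn) fun hc => hne ?_
    have h1 := (integral_eq_zero_iff_of_nonneg_ae hnn hmass).1 hc.symm
    rw [← ae_eq_bot, ← eventually_false_iff_eq_bot]
    filter_upwards [h1, hpfin] with v h2 h3
    exact h3.ne' h2
  have hG₀ := hK.G₀_pos
  have hH₀ := hK.H₀_pos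
  refine S.contra (κ := H₀ * (G₀ * (1 / 4) ^ k)) (H := H) (by positivity) (K_low hK) hm ?_ hunb
  intro t ht
  rw [hFin t ht, ← (hmc t ht).2]
  refine integral_congr_ae ?_
  filter_upwards [ae_pos_of_conc (hw.conc t ht)] with v hv
  exact abs_of_pos hv
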